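/- arXiv:cond-mat/0404108 — 6 statements merged into one kernel-verified Lean document; each statement's English description precedes it below -/
import Mathlib

section
/- The quartic polynomial P(z) = (q − σ²z²/2 − bz)(λ⁺ − z)(λ⁻ − z) − c⁺z(λ⁻ − z) − c⁻z(λ⁺ − z) has exactly four roots in ℂ, all of which are real and simple, and they can be labelled β⁻₂, β⁻₁, β⁺₁, β⁺₂ so that β⁻₂ < λ⁻ < β⁻₁ < 0 < β⁺₁ < λ⁺ < β⁺₂. -/
/-- A real quartic with negative leading coefficient is negative at some point right of `y`. -/
lemma exists_gt_quartic_neg {k : ℝ} (hk : 0 < k) (a₃ a₂ a₁ a₀ y : ℝ) :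
    ∃ x, y < x ∧ -k * x ^ 4 + a₃ * x ^ 3 + a₂ * x ^ 2 + a₁ * x + a₀ < 0 := by
  set S := |a₃| + |a₂| + |a₁| + |a₀| with hS
  have hS0 : 0 ≤ S / k := by positivity
  have hy := abs_nonneg y
  set x := |y| + 1 + S / k with hx
  have hx1 : 1 ≤ x := by linarith
  have hkx : S < k * x := by
    have : k * (S / k) = S := by field_simp
    nlinarith
  have h3 : 0 < x ^ 3 := by positivity
  have e3 : a₃ * x ^ 3 ≤ |a₃| * x ^ 3 := by gcongr; exact le_abs_self _
  have e2 : a₂ * x ^ 2 ≤ |a₂| * x ^ 3 := by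
    gcongr
    · exact le_abs_self _
    · norm_num
  have e1 : a₁ * x ≤ |a₁| * x ^ 3 := by
    gcongr
    · exact le_abs_self _
    · exact le_self_pow₀ hx1 (by norm_num)
  have e0 : a₀ ≤ |a₀| * x ^ 3 :=
    (le_abs_self _).trans (le_mul_of_one_le_right (abs_nonneg _) (one_le_pow₀ hx1))
  refine ⟨x, by linarith [le_abs_self y], ?_⟩
  have := mul_lt_mul_of_pos_right hkx h3
  rw [hS] at this
  linarith

/-- A real quartic with negative leading coefficient is negative at some point left of `y`. -/
lemma exists_lt_quartic_neg {k : ℝ} (hk : 0 < k) (a₃ a₂ a₁ a₀ y : ℝ) :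
    ∃ x, x < y ∧ -k * x ^ 4 + a₃ * x ^ 3 + a₂ * x ^ 2 + a₁ * x + a₀ < 0 := by
  obtain ⟨x, hx, h⟩ := exists_gt_quartic_neg hk (-a₃) a₂ (-a₁) a₀ (-y)
  exact ⟨-x, by linarith, by linarith⟩

/-- A quartic over a field with four distinct roots is the product of its leading coefficient and
the corresponding linear factors. -/
lemma quartic_eq_mul_of_roots {K : Type*} [Field K] {a₄ a₃ a₂ a₁ a₀ r s t u : K}
    (hrs : r ≠ s) (hrt : r ≠ t) (hru : r ≠ u) (hst : s ≠ t) (hsu : s ≠ u) (htu : t ≠ u)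
    (hr : a₄ * r ^ 4 + a₃ * r ^ 3 + a₂ * r ^ 2 + a₁ * r + a₀ = 0)
    (hs : a₄ * s ^ 4 + a₃ * s ^ 3 + a₂ * s ^ 2 + a₁ * s + a₀ = 0)
    (ht : a₄ * t ^ 4 + a₃ * t ^ 3 + a₂ * t ^ 2 + a₁ * t + a₀ = 0)
    (hu : a₄ * u ^ 4 + a₃ * u ^ 3 + a₂ * u ^ 2 + a₁ * u + a₀ = 0) (z : K) :
    a₄ * z ^ 4 + a₃ * z ^ 3 + a₂ * z ^ 2 + a₁ * z + a₀ =
      a₄ * (z - r) * (z - s) * (z - t) * (z - u) := by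
  have quotient_root : ∀ x, x ≠ r → a₄ * x ^ 4 + a₃ * x ^ 3 + a₂ * x ^ 2 + a₁ * x + a₀ = 0 →
      a₄ * (x ^ 3 + x ^ 2 * r + x * r ^ 2 + r ^ 3) + a₃ * (x ^ 2 + x * r + r ^ 2)
        + a₂ * (x + r) + a₁ = 0 := fun x hx h =>
    mul_left_cancel₀ (sub_ne_zero.2 hx) (by linear_combination h - hr)
  have hs' := quotient_root s hrs.symm hs
  have ht' := quotient_root t hrt.symm ht
  have hu' := quotient_root u hru.symm hu
  have ht'' : a₄ * (t ^ 2 + t * s + s ^ 2 + r * (t + s) + r ^ 2) + a₃ * (t + s + r) + a₂ = 0 :=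
    mul_left_cancel₀ (sub_ne_zero.2 hst.symm) (by linear_combination ht' - hs')
  have hu'' : a₄ * (u ^ 2 + u * s + s ^ 2 + r * (u + s) + r ^ 2) + a₃ * (u + s + r) + a₂ = 0 :=
    mul_left_cancel₀ (sub_ne_zero.2 hsu.symm) (by linear_combination hu' - hs')
  have hu_quot : a₄ * (u + t + s + r) + a₃ = 0 :=
    mul_left_cancel₀ (sub_ne_zero.2 htu.symm) (by linear_combination hu'' - ht'')
  linear_combination hr + (z - r) * hs' + (z - r) * (z - s) * ht''
    + (z - r) * (z - s) * (z - t) * hu_quot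


/-- The quartic polynomial
`P(z) = (q − σ²z²/2 − bz)(λ⁺ − z)(λ⁻ − z) − c⁺z(λ⁻ − z) − c⁻z(λ⁺ − z)`
has exactly four roots in `ℂ`, all real and simple: it factors as
`P(z) = −(σ²/2)(z − β⁻₂)(z − β⁻₁)(z − β⁺₁)(z − β⁺₂)` with real numbers
`β⁻₂ < λ⁻ < β⁻₁ < 0 < β⁺₁ < λ⁺ < β⁺₂`; in particular the roots of `P`
are exactly these four (distinct) real numbers. -/
theorem stmt_1 (σ b cp cm lp lm q : ℝ)
    (hσ : 0 < σ) (hcp : 0 < cp) (hcm : 0 < cm) (hlp : 0 < lp) (hlm : lm < 0) (hq : 0 < q)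
    (P : ℂ → ℂ)
    (hP : ∀ z : ℂ, P z = (q - σ ^ 2 * z ^ 2 / 2 - b * z) * (lp - z) * (lm - z)
      - cp * z * (lm - z) - cm * z * (lp - z)) :
    ∃ bm2 bm1 bp1 bp2 : ℝ,
      bm2 < lm ∧ lm < bm1 ∧ bm1 < 0 ∧ 0 < bp1 ∧ bp1 < lp ∧ lp < bp2 ∧
      (∀ z : ℂ, P z = -(σ ^ 2 / 2) * (z - bm2) * (z - bm1) * (z - bp1) * (z - bp2)) ∧
      (∀ z : ℂ, P z = 0 ↔ (z = bm2 ∨ z = bm1 ∨ z = bp1 ∨ z = bp2)) := by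
  set a₃ := σ ^ 2 / 2 * (lp + lm) - b with ha₃
  set a₂ := q + b * (lp + lm) - σ ^ 2 / 2 * (lp * lm) + cp + cm with ha₂
  set a₁ := -(q * (lp + lm)) - b * (lp * lm) - cp * lm - cm * lp with ha₁
  set a₀ := q * (lp * lm) with ha₀
  let f : ℝ → ℝ := fun x => -(σ ^ 2 / 2) * x ^ 4 + a₃ * x ^ 3 + a₂ * x ^ 2 + a₁ * x + a₀
  have hf : Continuous f := by fun_prop
  have hk : 0 < σ ^ 2 / 2 := by positivity
  obtain ⟨l, hl, hfl⟩ : ∃ l, l < lm ∧ f l < 0 := exists_lt_quartic_neg hk a₃ a₂ a₁ a₀ lm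
  obtain ⟨m, hm, hfm⟩ : ∃ m, lp < m ∧ f m < 0 := exists_gt_quartic_neg hk a₃ a₂ a₁ a₀ lp
  have hflm : 0 < f lm := by
    have : f lm = cm * (-lm) * (lp - lm) := by simp only [f, ha₃, ha₂, ha₁, ha₀]; ring
    rw [this]
    exact mul_pos (mul_pos hcm (by linarith)) (by linarith)
  have hflp : 0 < f lp := by
    have : f lp = cp * lp * (lp - lm) := by simp only [f, ha₃, ha₂, ha₁, ha₀]; ring
    rw [this]
    exact mul_pos (mul_pos hcp hlp) (by linarith)
  have hf0 : f 0 < 0 := by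
    have : f 0 = q * (lp * lm) := by simp [f, ha₀]
    rw [this]
    exact mul_neg_of_pos_of_neg hq (mul_neg_of_pos_of_neg hlp hlm)
  obtain ⟨r, ⟨-, hr⟩, hfr⟩ := intermediate_value_Ioo hl.le hf.continuousOn ⟨hfl, hflm⟩
  obtain ⟨s, ⟨hs, hs0⟩, hfs⟩ := intermediate_value_Ioo' hlm.le hf.continuousOn ⟨hf0, hflm⟩
  obtain ⟨t, ⟨ht0, ht⟩, hft⟩ := intermediate_value_Ioo hlp.le hf.continuousOn ⟨hf0, hflp⟩
  obtain ⟨u, ⟨hu, -⟩, hfu⟩ := intermediate_value_Ioo' hm.le hf.continuousOn ⟨hfm, hflp⟩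
  have hPf : ∀ z : ℂ, P z = ((-(σ ^ 2 / 2) : ℝ) : ℂ) * z ^ 4 + a₃ * z ^ 3 + a₂ * z ^ 2
      + a₁ * z + a₀ := fun z => by
    rw [hP, ha₃, ha₂, ha₁, ha₀]
    push_cast
    ring
  have hfac : ∀ z : ℂ, P z = -(σ ^ 2 / 2) * (z - r) * (z - s) * (z - t) * (z - u) := fun z => by
    rw [hPf, quartic_eq_mul_of_roots (r := (r : ℂ)) (s := s) (t := t) (u := u)]
    · push_cast; rfl
    iterate 6 exact Complex.ofReal_injective.ne (by linarith)
    all_goals exact_mod_cast ‹_›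
  refine ⟨r, s, t, u, hr, hs, hs0, ht0, ht, hu, hfac, fun z => ?_⟩
  have hσ' : (σ : ℂ) ≠ 0 := Complex.ofReal_ne_zero.2 hσ.ne'
  rw [hfac]
  simp [sub_eq_zero, hσ', or_assoc]
end

section
/- Let σ₋ ∈ (β⁻₁, 0] and σ₊ ∈ [0, β⁺₁), and let g : ℝ → ℝ be measurable with |g(x)| ≤ C(e^{σ₋x} + e^{σ₊x}) for some C > 0 and all x. Then all iterated integrals in the compositions (qU⁺)(qU⁻)g and (qU⁻)(qU⁺)g converge absolutely, and for every real x, ((qU⁺)(qU⁻)g)(x) = ((qU⁻)(qU⁺)g)(x); that is, the EPV operators of the supremum and infimum processes commute on such functions. -/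
open MeasureTheory

/-- The EPV operator `qU⁺` of the supremum process:
`(qU⁺u)(x) = Σ_{j=1,2} a⁺_j ∫₀^∞ e^{−β⁺_j y} u(x+y) dy`. -/
noncomputable def epvSup (bp1 bp2 a1 a2 : ℝ) (u : ℝ → ℝ) (x : ℝ) : ℝ :=
  a1 * (∫ y in Set.Ioi (0 : ℝ), Real.exp (-bp1 * y) * u (x + y))
    + a2 * (∫ y in Set.Ioi (0 : ℝ), Real.exp (-bp2 * y) * u (x + y))

/-- The EPV operator `qU⁻` of the infimum process:
`(qU⁻u)(x) = Σ_{j=1,2} (−a⁻_j) ∫_{−∞}^0 e^{−β⁻_j y} u(x+y) dy`. -/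
noncomputable def epvInf (bm1 bm2 a1 a2 : ℝ) (u : ℝ → ℝ) (x : ℝ) : ℝ :=
  (-a1) * (∫ y in Set.Iio (0 : ℝ), Real.exp (-bm1 * y) * u (x + y))
    + (-a2) * (∫ y in Set.Iio (0 : ℝ), Real.exp (-bm2 * y) * u (x + y))

open Set

theorem integrableOn_exp_mul_Iio {a : ℝ} (ha : 0 < a) :
    IntegrableOn (fun z : ℝ => Real.exp (a * z)) (Iio 0) :=
  (integrableOn_exp_mul_Iic ha 0).mono_set Iio_subset_Iic_self

/-- The exponentially weighted translate of a function dominated by `e^{sx} + e^{tx}` is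
integrable wherever the corresponding pure exponentials are. -/
theorem integrableOn_exp_mul_comp_add {S : Set ℝ} {s t b C : ℝ} {g : ℝ → ℝ}
    (hgm : Measurable g) (hg : ∀ x : ℝ, |g x| ≤ C * (Real.exp (s * x) + Real.exp (t * x)))
    (hs : IntegrableOn (fun y : ℝ => Real.exp ((s - b) * y)) S)
    (ht : IntegrableOn (fun y : ℝ => Real.exp ((t - b) * y)) S) (x : ℝ) :
    IntegrableOn (fun y => Real.exp (-b * y) * g (x + y)) S := by
  refine Integrable.mono' ((hs.const_mul (C * Real.exp (s * x))).add
    (ht.const_mul (C * Real.exp (t * x)))) (by fun_prop) (.of_forall fun y => ?_)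
  rw [Real.norm_eq_abs, abs_mul, Real.abs_exp]
  refine (mul_le_mul_of_nonneg_left (hg (x + y)) (Real.exp_pos _).le).trans_eq ?_
  have key (r : ℝ) : Real.exp (-b * y) * Real.exp (r * (x + y)) =
      Real.exp (r * x) * Real.exp ((r - b) * y) := by
    rw [← Real.exp_add, ← Real.exp_add]; ring_nf
  simp only [Pi.add_apply]
  linear_combination C * key s + C * key t

/-- Two-variable version of `integrableOn_exp_mul_comp_add` on a product set. -/
theorem integrable_prod_exp_mul_comp_add {S T : Set ℝ} {s t p m C : ℝ} {g : ℝ → ℝ}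
    (hgm : Measurable g) (hg : ∀ x : ℝ, |g x| ≤ C * (Real.exp (s * x) + Real.exp (t * x)))
    (hsp : IntegrableOn (fun y : ℝ => Real.exp ((s - p) * y)) S)
    (htp : IntegrableOn (fun y : ℝ => Real.exp ((t - p) * y)) S)
    (hsm : IntegrableOn (fun y : ℝ => Real.exp ((s - m) * y)) T)
    (htm : IntegrableOn (fun y : ℝ => Real.exp ((t - m) * y)) T) (x : ℝ) :
    Integrable (fun q : ℝ × ℝ => Real.exp (-p * q.1) * (Real.exp (-m * q.2) * g (x + q.1 + q.2)))
      ((volume.restrict S).prod (volume.restrict T)) := by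
  refine Integrable.mono' (((hsp.mul_prod hsm).const_mul (C * Real.exp (s * x))).add
    ((htp.mul_prod htm).const_mul (C * Real.exp (t * x)))) (by fun_prop) (.of_forall fun q => ?_)
  rw [Real.norm_eq_abs, abs_mul, abs_mul, Real.abs_exp, Real.abs_exp]
  refine (mul_le_mul_of_nonneg_left (mul_le_mul_of_nonneg_left (hg (x + q.1 + q.2))
    (Real.exp_pos _).le) (Real.exp_pos _).le).trans_eq ?_
  have key (r : ℝ) : Real.exp (-p * q.1) * (Real.exp (-m * q.2) *
      Real.exp (r * (x + q.1 + q.2))) =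
      Real.exp (r * x) * (Real.exp ((r - p) * q.1) * Real.exp ((r - m) * q.2)) := by
    simp only [← Real.exp_add]; ring_nf
  simp only [Pi.add_apply]
  linear_combination C * key s + C * key t

/-- Exponentially weighted integrals over two sets commute and converge absolutely, given joint
integrability. -/
theorem exp_mul_integral_comm {S T : Set ℝ} {p m : ℝ} {g : ℝ → ℝ} {x : ℝ}
    (h : Integrable
      (fun q : ℝ × ℝ => Real.exp (-p * q.1) * (Real.exp (-m * q.2) * g (x + q.1 + q.2)))
      ((volume.restrict S).prod (volume.restrict T))) :
    IntegrableOn (fun y => Real.exp (-p * y) * ∫ z in T, Real.exp (-m * z) * g (x + y + z)) S ∧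
    IntegrableOn (fun z => Real.exp (-m * z) * ∫ y in S, Real.exp (-p * y) * g (x + z + y)) T ∧
    ∫ y in S, Real.exp (-p * y) * ∫ z in T, Real.exp (-m * z) * g (x + y + z) =
      ∫ z in T, Real.exp (-m * z) * ∫ y in S, Real.exp (-p * y) * g (x + z + y) := by
  have e1 (y : ℝ) : ∫ z in T, Real.exp (-p * y) * (Real.exp (-m * z) * g (x + y + z)) =
      Real.exp (-p * y) * ∫ z in T, Real.exp (-m * z) * g (x + y + z) :=
    integral_const_mul _ _
  have e2 (z : ℝ) : ∫ y in S, Real.exp (-p * y) * (Real.exp (-m * z) * g (x + y + z)) =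
      Real.exp (-m * z) * ∫ y in S, Real.exp (-p * y) * g (x + z + y) := by
    rw [← integral_const_mul]
    congr 1 with y
    rw [add_right_comm x y z]
    ring
  refine ⟨?_, ?_, ?_⟩
  · simpa only [IntegrableOn, e1] using h.integral_prod_left
  · simpa only [IntegrableOn, e2] using h.integral_prod_right
  · simpa only [e1, e2] using integral_integral_swap
      (f := fun y z => Real.exp (-p * y) * (Real.exp (-m * z) * g (x + y + z))) h

/-- for `σ₋ ∈ (β⁻₁, 0]`, `σ₊ ∈ [0, β⁺₁)` and measurable `g` with
`|g(x)| ≤ C(e^{σ₋x} + e^{σ₊x})`, all iterated integrals in `(qU⁺)(qU⁻)g` and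
`(qU⁻)(qU⁺)g` converge absolutely and the two compositions agree at every `x`:
the EPV operators of the supremum and infimum processes commute on such functions. -/
theorem stmt_8 (lp lm bm2 bm1 bp1 bp2 : ℝ)
    (ho1 : bm2 < lm) (ho2 : lm < bm1) (ho3 : bm1 < 0)
    (ho4 : 0 < bp1) (ho5 : bp1 < lp) (ho6 : lp < bp2)
    (ap1 ap2 am1 am2 : ℝ)
    (hap1 : ap1 = bp1 * bp2 * (lp - bp1) / ((bp2 - bp1) * lp))
    (hap2 : ap2 = bp1 * bp2 * (lp - bp2) / ((bp1 - bp2) * lp))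
    (ham1 : am1 = bm1 * bm2 * (lm - bm1) / ((bm2 - bm1) * lm))
    (ham2 : am2 = bm1 * bm2 * (lm - bm2) / ((bm1 - bm2) * lm))
    (σm σp : ℝ) (hσm1 : bm1 < σm) (hσm2 : σm ≤ 0) (hσp1 : 0 ≤ σp) (hσp2 : σp < bp1)
    (C : ℝ) (hC : 0 < C)
    (g : ℝ → ℝ) (hgm : Measurable g)
    (hg : ∀ x : ℝ, |g x| ≤ C * (Real.exp (σm * x) + Real.exp (σp * x))) :
    (∀ x : ℝ, IntegrableOn (fun y => Real.exp (-bm1 * y) * g (x + y)) (Set.Iio 0)) ∧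
    (∀ x : ℝ, IntegrableOn (fun y => Real.exp (-bm2 * y) * g (x + y)) (Set.Iio 0)) ∧
    (∀ x : ℝ, IntegrableOn (fun y => Real.exp (-bp1 * y) * g (x + y)) (Set.Ioi 0)) ∧
    (∀ x : ℝ, IntegrableOn (fun y => Real.exp (-bp2 * y) * g (x + y)) (Set.Ioi 0)) ∧
    (∀ x : ℝ, IntegrableOn
      (fun y => Real.exp (-bp1 * y) * epvInf bm1 bm2 am1 am2 g (x + y)) (Set.Ioi 0)) ∧
    (∀ x : ℝ, IntegrableOn
      (fun y => Real.exp (-bp2 * y) * epvInf bm1 bm2 am1 am2 g (x + y)) (Set.Ioi 0)) ∧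
    (∀ x : ℝ, IntegrableOn
      (fun y => Real.exp (-bm1 * y) * epvSup bp1 bp2 ap1 ap2 g (x + y)) (Set.Iio 0)) ∧
    (∀ x : ℝ, IntegrableOn
      (fun y => Real.exp (-bm2 * y) * epvSup bp1 bp2 ap1 ap2 g (x + y)) (Set.Iio 0)) ∧
    (∀ x : ℝ, epvSup bp1 bp2 ap1 ap2 (epvInf bm1 bm2 am1 am2 g) x
      = epvInf bm1 bm2 am1 am2 (epvSup bp1 bp2 ap1 ap2 g) x) := by
  have neg_int {r b : ℝ} (h : r < b) :
      IntegrableOn (fun y : ℝ => Real.exp ((r - b) * y)) (Ioi 0) :=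
    integrableOn_exp_mul_Ioi (sub_neg.2 h) 0
  have pos_int {r b : ℝ} (h : b < r) :
      IntegrableOn (fun y : ℝ => Real.exp ((r - b) * y)) (Iio 0) :=
    integrableOn_exp_mul_Iio (sub_pos.2 h)
  have single_inf {m : ℝ} (hm : m ≤ bm1) (x : ℝ) :
      IntegrableOn (fun y => Real.exp (-m * y) * g (x + y)) (Iio 0) :=
    integrableOn_exp_mul_comp_add hgm hg (pos_int (by linarith)) (pos_int (by linarith)) x
  have single_sup {p : ℝ} (hp : bp1 ≤ p) (x : ℝ) :
      IntegrableOn (fun y => Real.exp (-p * y) * g (x + y)) (Ioi 0) :=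
    integrableOn_exp_mul_comp_add hgm hg (neg_int (by linarith)) (neg_int (by linarith)) x
  have comm {p m : ℝ} (hp : bp1 ≤ p) (hm : m ≤ bm1) (x : ℝ) :=
    exp_mul_integral_comm (integrable_prod_exp_mul_comp_add hgm hg
      (neg_int (show σm < p by linarith)) (neg_int (show σp < p by linarith))
      (pos_int (show m < σm by linarith)) (pos_int (show m < σp by linarith)) x)
  have hp2 : bp1 ≤ bp2 := by linarith
  have hm2 : bm2 ≤ bm1 := by linarith
  have sup_expand (p x : ℝ) : (fun y => Real.exp (-p * y) * epvInf bm1 bm2 am1 am2 g (x + y)) =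
      fun y => (-am1) * (Real.exp (-p * y) * ∫ z in Iio 0, Real.exp (-bm1 * z) * g (x + y + z)) +
        (-am2) * (Real.exp (-p * y) * ∫ z in Iio 0, Real.exp (-bm2 * z) * g (x + y + z)) := by
    funext y
    simp only [epvInf]
    ring
  have inf_expand (m x : ℝ) : (fun z => Real.exp (-m * z) * epvSup bp1 bp2 ap1 ap2 g (x + z)) =
      fun z => ap1 * (Real.exp (-m * z) * ∫ y in Ioi 0, Real.exp (-bp1 * y) * g (x + z + y)) +
        ap2 * (Real.exp (-m * z) * ∫ y in Ioi 0, Real.exp (-bp2 * y) * g (x + z + y)) := by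
    funext z
    simp only [epvSup]
    ring
  have iter_sup {p : ℝ} (hp : bp1 ≤ p) (x : ℝ) : IntegrableOn
      (fun y => Real.exp (-p * y) * epvInf bm1 bm2 am1 am2 g (x + y)) (Ioi 0) := by
    rw [sup_expand]
    exact ((comm hp le_rfl x).1.const_mul _).add ((comm hp hm2 x).1.const_mul _)
  have iter_inf {m : ℝ} (hm : m ≤ bm1) (x : ℝ) : IntegrableOn
      (fun z => Real.exp (-m * z) * epvSup bp1 bp2 ap1 ap2 g (x + z)) (Iio 0) := by
    rw [inf_expand]
    exact ((comm le_rfl hm x).2.1.const_mul _).add ((comm hp2 hm x).2.1.const_mul _)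
  refine ⟨single_inf le_rfl, single_inf hm2, single_sup le_rfl, single_sup hp2,
    iter_sup le_rfl, iter_sup hp2, iter_inf le_rfl, iter_inf hm2, fun x => ?_⟩
  rw [epvSup, epvInf.eq_def _ _ _ _ (epvSup _ _ _ _ _), sup_expand, sup_expand, inf_expand,
    inf_expand,
    integral_add ((comm le_rfl le_rfl x).1.const_mul _) ((comm le_rfl hm2 x).1.const_mul _),
    integral_add ((comm hp2 le_rfl x).1.const_mul _) ((comm hp2 hm2 x).1.const_mul _),
    integral_add ((comm le_rfl le_rfl x).2.1.const_mul _) ((comm hp2 le_rfl x).2.1.const_mul _),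
    integral_add ((comm le_rfl hm2 x).2.1.const_mul _) ((comm hp2 hm2 x).2.1.const_mul _)]
  simp only [integral_const_mul]
  rw [(comm le_rfl le_rfl x).2.2, (comm le_rfl hm2 x).2.2, (comm hp2 le_rfl x).2.2,
    (comm hp2 hm2 x).2.2]
  ring
end

section
/- Let q > 0, K > 0, and let δ : ℝ → ℝ be nondecreasing and nonnegative with lim_{x→−∞} δ(x) = 0 and lim_{x→+∞} δ(x) = +∞. Define W(x) = q^{−1} Σ_{j=1,2} (−a⁻_j) ∫_{−∞}^0 e^{−β⁻_j y} δ(x+y) dy − K. Then W is finite, continuous and nondecreasing, lim_{x→−∞} W(x) = −K and lim_{x→+∞} W(x) = +∞; consequently there exists h* ∈ ℝ with W(h*) = 0 (the optimal exercise threshold of the perpetual American call on the asset with dividend stream δ). If in addition δ is strictly increasing, then this h* is unique. -/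
open MeasureTheory Filter

section ExponentialWeight

variable {c : ℝ} {δ : ℝ → ℝ}

lemma integrableOn_exp_neg_mul_Iio (hc : c < 0) :
    IntegrableOn (fun y => Real.exp (-c * y)) (Set.Iio 0) :=
  (integrableOn_exp_mul_Iic (neg_pos.2 hc) 0).mono_set Set.Iio_subset_Iic_self

lemma integrableOn_exp_mul_monotone (hc : c < 0) (hmono : Monotone δ) (hpos : ∀ x, 0 ≤ δ x)
    (x : ℝ) : IntegrableOn (fun y => Real.exp (-c * y) * δ (x + y)) (Set.Iio 0) := by
  refine Integrable.mono' ((integrableOn_exp_neg_mul_Iio hc).mul_const (δ x)) ?_ ?_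
  · have := hmono.measurable
    fun_prop
  · filter_upwards [ae_restrict_mem measurableSet_Iio] with y hy
    rw [Real.norm_of_nonneg (mul_nonneg (Real.exp_nonneg _) (hpos _))]
    gcongr
    exact hmono (by linarith [Set.mem_Iio.1 hy])

lemma monotone_integral_exp_mul (hc : c < 0) (hmono : Monotone δ) (hpos : ∀ x, 0 ≤ δ x) :
    Monotone fun x => ∫ y in Set.Iio (0 : ℝ), Real.exp (-c * y) * δ (x + y) := fun x z hxz =>
  integral_mono (integrableOn_exp_mul_monotone hc hmono hpos x)
    (integrableOn_exp_mul_monotone hc hmono hpos z) fun y =>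
      mul_le_mul_of_nonneg_left (hmono (by linarith)) (Real.exp_nonneg _)

lemma strictMono_integral_exp_mul (hc : c < 0) (hmono : StrictMono δ) (hpos : ∀ x, 0 ≤ δ x) :
    StrictMono fun x => ∫ y in Set.Iio (0 : ℝ), Real.exp (-c * y) * δ (x + y) := by
  intro x z hxz
  have hx := integrableOn_exp_mul_monotone hc hmono.monotone hpos x
  have hz := integrableOn_exp_mul_monotone hc hmono.monotone hpos z
  have hlt : ∀ y, 0 < Real.exp (-c * y) * δ (z + y) - Real.exp (-c * y) * δ (x + y) := fun y =>
    sub_pos.2 (mul_lt_mul_of_pos_left (hmono (by linarith)) (Real.exp_pos _))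
  rw [← sub_pos, ← integral_sub hz hx,
    integral_pos_iff_support_of_nonneg (fun y => (hlt y).le) (hz.sub hx),
    Function.support_eq_univ fun y => (hlt y).ne']
  simp

lemma continuous_integral_exp_mul (hc : c < 0) (hmono : Monotone δ) (hpos : ∀ x, 0 ≤ δ x) :
    Continuous fun x => ∫ y in Set.Iio (0 : ℝ), Real.exp (-c * y) * δ (x + y) := by
  refine continuous_iff_continuousAt.2 fun x₀ => ?_
  refine continuousAt_of_dominated (bound := fun y => Real.exp (-c * y) * δ (x₀ + 1)) ?_ ?_
    ((integrableOn_exp_neg_mul_Iio hc).mul_const _) ?_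
  · exact .of_forall fun x => (integrableOn_exp_mul_monotone hc hmono hpos x).1
  · filter_upwards [Iio_mem_nhds (lt_add_one x₀)] with x hx
    filter_upwards [ae_restrict_mem measurableSet_Iio] with y hy
    rw [Real.norm_of_nonneg (mul_nonneg (Real.exp_nonneg _) (hpos _))]
    gcongr
    exact hmono (by linarith [Set.mem_Iio.1 hy, Set.mem_Iio.1 hx])
  · have hcount : {y | ¬ContinuousAt δ (x₀ + y)}.Countable :=
      hmono.countable_not_continuousAt.preimage (add_right_injective x₀)
    refine ae_restrict_of_ae ?_
    filter_upwards [hcount.ae_notMem volume] with y hy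
    have hy : ContinuousAt δ (x₀ + y) := not_not.1 hy
    exact continuousAt_const.mul
      (ContinuousAt.comp (f := fun x => x + y) hy (by fun_prop))

lemma tendsto_integral_exp_mul_atBot (hc : c < 0) (hmono : Monotone δ) (hpos : ∀ x, 0 ≤ δ x)
    (hbot : Tendsto δ atBot (nhds 0)) :
    Tendsto (fun x => ∫ y in Set.Iio (0 : ℝ), Real.exp (-c * y) * δ (x + y)) atBot (nhds 0) := by
  have hlim := hbot.const_mul (∫ y in Set.Iio (0 : ℝ), Real.exp (-c * y))
  rw [mul_zero] at hlim
  refine squeeze_zero (fun x => integral_nonneg fun y => mul_nonneg (Real.exp_nonneg _) (hpos _))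
    (fun x => ?_) hlim
  rw [← integral_mul_const]
  refine setIntegral_mono_on (integrableOn_exp_mul_monotone hc hmono hpos x)
    ((integrableOn_exp_neg_mul_Iio hc).mul_const _) measurableSet_Iio fun y hy => ?_
  gcongr
  exact hmono (by linarith [Set.mem_Iio.1 hy])

lemma tendsto_integral_exp_mul_atTop (hc : c < 0) (hmono : Monotone δ) (hpos : ∀ x, 0 ≤ δ x)
    (htop : Tendsto δ atTop atTop) :
    Tendsto (fun x => ∫ y in Set.Iio (0 : ℝ), Real.exp (-c * y) * δ (x + y)) atTop atTop := by
  have hsub : Set.Ioo (-1 : ℝ) 0 ⊆ Set.Iio 0 := Set.Ioo_subset_Iio_self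
  have hexp := (integrableOn_exp_neg_mul_Iio hc).mono_set hsub
  have hpos' : 0 < ∫ y in Set.Ioo (-1 : ℝ) 0, Real.exp (-c * y) := by
    rw [integral_pos_iff_support_of_nonneg (fun y => Real.exp_nonneg _) hexp,
      Function.support_eq_univ fun y => (Real.exp_pos _).ne']
    simp
  have hshift : Tendsto (fun x => δ (x - 1)) atTop atTop :=
    htop.comp (tendsto_atTop_add_const_right atTop (-1) tendsto_id)
  refine tendsto_atTop_mono (fun x => ?_) (hshift.const_mul_atTop hpos')
  have hint := integrableOn_exp_mul_monotone hc hmono hpos x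
  rw [← integral_mul_const]
  refine (setIntegral_mono_on (hexp.mul_const _) (hint.mono_set hsub) measurableSet_Ioo
    fun y hy => ?_).trans (setIntegral_mono_set hint
      (.of_forall fun y => mul_nonneg (Real.exp_nonneg _) (hpos _)) hsub.eventuallyLE)
  gcongr
  exact hmono (by linarith [hy.1])

end ExponentialWeight

/-- let `q > 0`, `K > 0`, and let `δ` be nondecreasing and nonnegative with
`δ(x) → 0` as `x → −∞` and `δ(x) → +∞` as `x → +∞`. Then
`W(x) = q⁻¹ Σ_{j=1,2} (−a⁻_j) ∫_{−∞}^0 e^{−β⁻_j y} δ(x+y) dy − K` is finite (the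
integrals converge), continuous and nondecreasing, `W(x) → −K` as `x → −∞` and
`W(x) → +∞` as `x → +∞`; consequently there is `h* ∈ ℝ` with `W(h*) = 0` (the optimal
exercise threshold of the perpetual American call), unique if `δ` is strictly
increasing. -/
theorem stmt_10 (bm2 bm1 lm : ℝ) (h1 : bm2 < lm) (h2 : lm < bm1) (h3 : bm1 < 0)
    (am1 am2 : ℝ)
    (ham1 : am1 = bm1 * bm2 * (lm - bm1) / ((bm2 - bm1) * lm))
    (ham2 : am2 = bm1 * bm2 * (lm - bm2) / ((bm1 - bm2) * lm))
    (q K : ℝ) (hq : 0 < q) (hK : 0 < K)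
    (δ : ℝ → ℝ) (hmono : Monotone δ) (hpos : ∀ x, 0 ≤ δ x)
    (hbot : Tendsto δ atBot (nhds 0)) (htop : Tendsto δ atTop atTop)
    (W : ℝ → ℝ)
    (hW : ∀ x : ℝ, W x = q⁻¹ *
      ((-am1) * (∫ y in Set.Iio (0 : ℝ), Real.exp (-bm1 * y) * δ (x + y))
        + (-am2) * (∫ y in Set.Iio (0 : ℝ), Real.exp (-bm2 * y) * δ (x + y))) - K) :
    (∀ x : ℝ, IntegrableOn (fun y => Real.exp (-bm1 * y) * δ (x + y)) (Set.Iio 0)) ∧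
    (∀ x : ℝ, IntegrableOn (fun y => Real.exp (-bm2 * y) * δ (x + y)) (Set.Iio 0)) ∧
    Continuous W ∧ Monotone W ∧
    Tendsto W atBot (nhds (-K)) ∧ Tendsto W atTop atTop ∧
    (∃ hstar : ℝ, W hstar = 0) ∧
    (StrictMono δ → ∃! hstar : ℝ, W hstar = 0) := by
  have hlm : lm < 0 := h2.trans h3
  have hb2 : bm2 < 0 := h1.trans hlm
  have hprod : 0 < bm1 * bm2 := mul_pos_of_neg_of_neg h3 hb2
  have ha1 : 0 < -am1 := by
    rw [ham1, neg_pos]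
    exact div_neg_of_neg_of_pos (mul_neg_of_pos_of_neg hprod (by linarith))
      (mul_pos_of_neg_of_neg (by linarith) hlm)
  have ha2 : 0 < -am2 := by
    rw [ham2, neg_pos]
    exact div_neg_of_pos_of_neg (mul_pos hprod (by linarith))
      (mul_neg_of_pos_of_neg (by linarith) hlm)
  have hq' : 0 < q⁻¹ := inv_pos.2 hq
  have hcont : Continuous W := by
    rw [funext hW]
    exact ((((continuous_integral_exp_mul h3 hmono hpos).const_mul _).add
      ((continuous_integral_exp_mul hb2 hmono hpos).const_mul _)).const_mul _).sub
        continuous_const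
  have hlimBot : Tendsto W atBot (nhds (-K)) := by
    rw [funext hW]
    simpa using (((((tendsto_integral_exp_mul_atBot h3 hmono hpos hbot).const_mul (-am1)).add
      ((tendsto_integral_exp_mul_atBot hb2 hmono hpos hbot).const_mul (-am2))).const_mul
        q⁻¹).sub_const K)
  have hlimTop : Tendsto W atTop atTop := by
    rw [funext hW]
    exact tendsto_atTop_add_const_right _ (-K)
      ((((tendsto_integral_exp_mul_atTop h3 hmono hpos htop).const_mul_atTop ha1).atTop_add_atTop
        ((tendsto_integral_exp_mul_atTop hb2 hmono hpos htop).const_mul_atTop ha2)).const_mul_atTop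
          hq')
  obtain ⟨u, hu⟩ := (hlimBot.eventually (gt_mem_nhds (neg_neg_of_pos hK))).exists
  obtain ⟨v, hv⟩ := (hlimTop.eventually_ge_atTop 0).exists
  obtain ⟨h, hh⟩ := mem_range_of_exists_le_of_exists_ge hcont ⟨u, hu.le⟩ ⟨v, hv⟩
  refine ⟨integrableOn_exp_mul_monotone h3 hmono hpos, integrableOn_exp_mul_monotone hb2 hmono hpos,
    hcont, fun x z hxz => ?_, hlimBot, hlimTop, ⟨h, hh⟩, fun hstrict => ⟨h, hh, fun z hz => ?_⟩⟩
  · have hle1 := mul_le_mul_of_nonneg_left (monotone_integral_exp_mul h3 hmono hpos hxz) ha1.le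
    have hle2 := mul_le_mul_of_nonneg_left (monotone_integral_exp_mul hb2 hmono hpos hxz) ha2.le
    rw [hW, hW]
    exact sub_le_sub_right (mul_le_mul_of_nonneg_left (add_le_add hle1 hle2) hq'.le) K
  · refine StrictMono.injective (f := W) (fun x z hxz => ?_) (hz.trans hh.symm)
    have hlt1 := mul_lt_mul_of_pos_left (strictMono_integral_exp_mul h3 hstrict hpos hxz) ha1
    have hlt2 := mul_lt_mul_of_pos_left (strictMono_integral_exp_mul hb2 hstrict hpos hxz) ha2
    rw [hW, hW]
    exact sub_lt_sub_right (mul_lt_mul_of_pos_left (add_lt_add hlt1 hlt2) hq') K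
end

section
/- Let q > 0, K > 0, σ ∈ [0, β⁺₁), C₀ > 0, and let δ : ℝ → ℝ be nondecreasing with 0 ≤ δ(x) ≤ C₀(1 + e^{σx}) for all x, lim_{x→−∞} δ(x) = 0, and liminf_{x→+∞} δ(x) > qK. Define w(x) = K − q^{−1} Σ_{k=1,2} a⁺_k ∫₀^∞ e^{−β⁺_k y} δ(x+y) dy. Then w is finite, continuous and nonincreasing, lim_{x→−∞} w(x) = K, and w(x) < 0 for all sufficiently large x; consequently there exists h_* ∈ ℝ with w(h_*) = 0 (the optimal exercise threshold of the perpetual American put on the asset with dividend stream δ). If in addition δ is strictly increasing, then this h_* is unique. -/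
open MeasureTheory Filter

open Set in
/-- A monotone nonnegative function of exponential order `σ < β` has a convergent translated
Laplace integral at `β`. -/
lemma integrableOn_exp_mul_translate {β σ C : ℝ} (hβ : 0 < β) (hσ : σ < β) {δ : ℝ → ℝ}
    (hmono : Monotone δ) (hpos : ∀ x, 0 ≤ δ x) (hbound : ∀ x, δ x ≤ C * (1 + Real.exp (σ * x)))
    (x : ℝ) : IntegrableOn (fun y => Real.exp (-β * y) * δ (x + y)) (Ioi 0) := by
  have hmeas : Measurable δ := hmono.measurable
  have hdom : IntegrableOn (fun y => C * (Real.exp (-β * y)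
      + Real.exp (σ * x) * Real.exp ((σ - β) * y))) (Ioi 0) :=
    ((integrableOn_exp_mul_Ioi (by linarith) 0).add
      ((integrableOn_exp_mul_Ioi (by linarith) 0).const_mul _)).const_mul _
  refine hdom.mono' (by fun_prop) (ae_of_all _ fun y => ?_)
  rw [Real.norm_of_nonneg (mul_nonneg (Real.exp_pos _).le (hpos _))]
  calc Real.exp (-β * y) * δ (x + y)
      ≤ Real.exp (-β * y) * (C * (1 + Real.exp (σ * (x + y)))) := by gcongr; exact hbound _
    _ = C * (Real.exp (-β * y) + Real.exp (-β * y) * Real.exp (σ * (x + y))) := by ring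
    _ = C * (Real.exp (-β * y) + Real.exp (σ * x) * Real.exp ((σ - β) * y)) := by
        rw [← Real.exp_add, ← Real.exp_add]; ring_nf

section TranslatedLaplace

open Set

variable {β : ℝ} {δ : ℝ → ℝ}

lemma monotone_integral_exp_mul_translate (hmono : Monotone δ)
    (hfi : ∀ x, IntegrableOn (fun y => Real.exp (-β * y) * δ (x + y)) (Ioi 0)) :
    Monotone fun x => ∫ y in Ioi (0 : ℝ), Real.exp (-β * y) * δ (x + y) := fun a b hab =>
  integral_mono (hfi a) (hfi b) fun y =>
    mul_le_mul_of_nonneg_left (hmono (by linarith)) (Real.exp_pos _).le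

lemma strictMono_integral_exp_mul_translate (hmono : StrictMono δ)
    (hfi : ∀ x, IntegrableOn (fun y => Real.exp (-β * y) * δ (x + y)) (Ioi 0)) :
    StrictMono fun x => ∫ y in Ioi (0 : ℝ), Real.exp (-β * y) * δ (x + y) := by
  intro a b hab
  have hlt (y : ℝ) : Real.exp (-β * y) * δ (a + y) < Real.exp (-β * y) * δ (b + y) :=
    mul_lt_mul_of_pos_left (hmono (by linarith)) (Real.exp_pos _)
  rw [← sub_pos, ← integral_sub (hfi b) (hfi a), integral_pos_iff_support_of_nonneg
    (fun y => sub_nonneg.2 (hlt y).le) ((hfi b).sub (hfi a))]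
  have hsupp : Function.support (fun y => Real.exp (-β * y) * δ (b + y)
      - Real.exp (-β * y) * δ (a + y)) = univ :=
    eq_univ_of_forall fun y => (sub_pos.2 (hlt y)).ne'
  rw [hsupp]
  simp

/-- The translated Laplace integral of a monotone function is continuous in the translation, even
where the function itself jumps, since a monotone function has countably many jumps. -/
lemma continuous_integral_exp_mul_translate (hmono : Monotone δ) (hpos : ∀ x, 0 ≤ δ x)
    (hfi : ∀ x, IntegrableOn (fun y => Real.exp (-β * y) * δ (x + y)) (Ioi 0)) :
    Continuous fun x => ∫ y in Ioi (0 : ℝ), Real.exp (-β * y) * δ (x + y) := by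
  refine continuous_iff_continuousAt.2 fun x₀ => ?_
  refine continuousAt_of_dominated
    (bound := fun y => Real.exp (-β * y) * δ (x₀ + 1 + y))
    (Eventually.of_forall fun x => (hfi x).aestronglyMeasurable) ?_ (hfi _) ?_
  · filter_upwards [Iio_mem_nhds (lt_add_one x₀)] with x hx
    refine ae_of_all _ fun y => ?_
    rw [Real.norm_of_nonneg (mul_nonneg (Real.exp_pos _).le (hpos _))]
    exact mul_le_mul_of_nonneg_left (hmono (by linarith [mem_Iio.1 hx])) (Real.exp_pos _).le
  · refine ae_restrict_of_ae ?_
    have hcount : {y | ¬ ContinuousAt δ (x₀ + y)}.Countable :=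
      hmono.countable_not_continuousAt.preimage (add_right_injective x₀)
    filter_upwards [hcount.ae_notMem volume] with y hy
    have hy' : ContinuousAt δ (x₀ + y) := by simpa using hy
    exact continuousAt_const.mul
      (ContinuousAt.comp (f := fun x => x + y) hy' (continuousAt_id.add continuousAt_const))

lemma tendsto_integral_exp_mul_translate_atBot (hmono : Monotone δ) (hpos : ∀ x, 0 ≤ δ x)
    (hbot : Tendsto δ atBot (nhds 0))
    (hfi : ∀ x, IntegrableOn (fun y => Real.exp (-β * y) * δ (x + y)) (Ioi 0)) :
    Tendsto (fun x => ∫ y in Ioi (0 : ℝ), Real.exp (-β * y) * δ (x + y)) atBot (nhds 0) := by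
  have key := tendsto_integral_filter_of_dominated_convergence (l := atBot)
    (μ := volume.restrict (Ioi (0 : ℝ)))
    (F := fun x y => Real.exp (-β * y) * δ (x + y)) (f := fun _ => 0)
    (fun y => Real.exp (-β * y) * δ (0 + y))
    (Eventually.of_forall fun x => (hfi x).aestronglyMeasurable) ?_ (hfi 0) ?_
  · simpa using key
  · filter_upwards [eventually_le_atBot 0] with x hx
    refine ae_of_all _ fun y => ?_
    rw [Real.norm_of_nonneg (mul_nonneg (Real.exp_pos _).le (hpos _))]
    exact mul_le_mul_of_nonneg_left (hmono (by linarith)) (Real.exp_pos _).le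
  · refine ae_of_all _ fun y => ?_
    simpa using (hbot.comp (tendsto_atBot_add_const_right _ y tendsto_id)).const_mul
      (Real.exp (-β * y))

lemma div_le_integral_exp_mul_translate (hβ : 0 < β) (hmono : Monotone δ)
    (hfi : ∀ x, IntegrableOn (fun y => Real.exp (-β * y) * δ (x + y)) (Ioi 0))
    {M x : ℝ} (hM : M ≤ δ x) :
    M / β ≤ ∫ y in Ioi (0 : ℝ), Real.exp (-β * y) * δ (x + y) := by
  have hβ' : -β < 0 := by linarith
  calc M / β = ∫ y in Ioi (0 : ℝ), Real.exp (-β * y) * M := by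
        rw [integral_mul_const, integral_exp_mul_Ioi hβ' 0]
        simp [div_eq_mul_inv, mul_comm]
    _ ≤ _ := setIntegral_mono_on ((integrableOn_exp_mul_Ioi hβ' 0).mul_const M) (hfi x)
        measurableSet_Ioi fun y hy => mul_le_mul_of_nonneg_left
          (hM.trans (hmono (by linarith [mem_Ioi.1 hy]))) (Real.exp_pos _).le

end TranslatedLaplace

/-- let `q > 0`, `K > 0`, `σ ∈ [0, β⁺₁)`, `C₀ > 0`, and let `δ` be
nondecreasing with `0 ≤ δ(x) ≤ C₀(1 + e^{σx})`, `δ(x) → 0` as `x → −∞`, and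
`liminf_{x→+∞} δ(x) > qK` (i.e. eventually `δ(x) ≥ M` for some `M > qK`). Then
`w(x) = K − q⁻¹ Σ_{k=1,2} a⁺_k ∫₀^∞ e^{−β⁺_k y} δ(x+y) dy` is finite (the integrals
converge), continuous and nonincreasing, `w(x) → K` as `x → −∞`, and `w(x) < 0` for all
sufficiently large `x`; consequently there is `h_* ∈ ℝ` with `w(h_*) = 0` (the optimal
exercise threshold of the perpetual American put), unique if `δ` is strictly
increasing. -/
theorem stmt_11 (bp1 bp2 lp : ℝ) (h1 : 0 < bp1) (h2 : bp1 < lp) (h3 : lp < bp2)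
    (ap1 ap2 : ℝ)
    (hap1 : ap1 = bp1 * bp2 * (lp - bp1) / ((bp2 - bp1) * lp))
    (hap2 : ap2 = bp1 * bp2 * (lp - bp2) / ((bp1 - bp2) * lp))
    (q K σ C₀ : ℝ) (hq : 0 < q) (hK : 0 < K) (hσ1 : 0 ≤ σ) (hσ2 : σ < bp1) (hC₀ : 0 < C₀)
    (δ : ℝ → ℝ) (hmono : Monotone δ) (hpos : ∀ x, 0 ≤ δ x)
    (hbound : ∀ x, δ x ≤ C₀ * (1 + Real.exp (σ * x)))
    (hbot : Tendsto δ atBot (nhds 0))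
    (hliminf : ∃ M : ℝ, q * K < M ∧ ∀ᶠ x in atTop, M ≤ δ x)
    (w : ℝ → ℝ)
    (hw : ∀ x : ℝ, w x = K - q⁻¹ *
      (ap1 * (∫ y in Set.Ioi (0 : ℝ), Real.exp (-bp1 * y) * δ (x + y))
        + ap2 * (∫ y in Set.Ioi (0 : ℝ), Real.exp (-bp2 * y) * δ (x + y)))) :
    (∀ x : ℝ, IntegrableOn (fun y => Real.exp (-bp1 * y) * δ (x + y)) (Set.Ioi 0)) ∧
    (∀ x : ℝ, IntegrableOn (fun y => Real.exp (-bp2 * y) * δ (x + y)) (Set.Ioi 0)) ∧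
    Continuous w ∧ Antitone w ∧
    Tendsto w atBot (nhds K) ∧ (∀ᶠ x in atTop, w x < 0) ∧
    (∃ hstar : ℝ, w hstar = 0) ∧
    (StrictMono δ → ∃! hstar : ℝ, w hstar = 0) := by
  have hlp : 0 < lp := h1.trans h2
  have hb2 : 0 < bp2 := hlp.trans h3
  have ha1 : 0 < ap1 := by
    rw [hap1]
    exact div_pos (mul_pos (mul_pos h1 hb2) (by linarith)) (mul_pos (by linarith) hlp)
  have ha2 : 0 < ap2 := by
    rw [hap2]
    exact div_pos_of_neg_of_neg (mul_neg_of_pos_of_neg (mul_pos h1 hb2) (by linarith))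
      (mul_neg_of_neg_of_pos (by linarith) hlp)
  have hsum : ap1 / bp1 + ap2 / bp2 = 1 := by
    have hd : bp2 - bp1 ≠ 0 := by linarith
    have hd' : bp1 - bp2 ≠ 0 := by linarith
    rw [hap1, hap2, ← neg_sub bp2 bp1]
    field_simp
    ring
  have hfi1 := integrableOn_exp_mul_translate h1 hσ2 hmono hpos hbound
  have hfi2 := integrableOn_exp_mul_translate hb2 (by linarith : σ < bp2) hmono hpos hbound
  have hq' : 0 < q⁻¹ := inv_pos.2 hq
  have hcont : Continuous w := by
    rw [funext hw]
    exact continuous_const.sub (continuous_const.mul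
      ((continuous_const.mul (continuous_integral_exp_mul_translate hmono hpos hfi1)).add
        (continuous_const.mul (continuous_integral_exp_mul_translate hmono hpos hfi2))))
  have hanti : Antitone w := by
    intro a b hab
    have i1 := monotone_integral_exp_mul_translate hmono hfi1 hab
    have i2 := monotone_integral_exp_mul_translate hmono hfi2 hab
    dsimp only at i1 i2
    rw [hw, hw]
    gcongr
  have hlim : Tendsto w atBot (nhds K) := by
    rw [funext hw]
    simpa using ((((tendsto_integral_exp_mul_translate_atBot hmono hpos hbot hfi1).const_mul
      ap1).add ((tendsto_integral_exp_mul_translate_atBot hmono hpos hbot hfi2).const_mul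
      ap2)).const_mul q⁻¹).const_sub K
  have hneg : ∀ᶠ x in atTop, w x < 0 := by
    obtain ⟨M, hKM, hM⟩ := hliminf
    filter_upwards [hM] with x hx
    have i1 := div_le_integral_exp_mul_translate h1 hmono hfi1 hx
    have i2 := div_le_integral_exp_mul_translate hb2 hmono hfi2 hx
    rw [hw, sub_neg]
    calc K < q⁻¹ * M := by rwa [lt_inv_mul_iff₀ hq]
      _ = q⁻¹ * (ap1 * (M / bp1) + ap2 * (M / bp2)) := by
        rw [show ap1 * (M / bp1) + ap2 * (M / bp2) = (ap1 / bp1 + ap2 / bp2) * M by ring,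
          hsum, one_mul]
      _ ≤ _ := by gcongr
  have hex : ∃ hstar : ℝ, w hstar = 0 := by
    obtain ⟨b, hb⟩ := hneg.exists
    obtain ⟨a, ha⟩ := (hlim.eventually (lt_mem_nhds hK)).exists
    exact mem_range_of_exists_le_of_exists_ge hcont ⟨b, hb.le⟩ ⟨a, ha.le⟩
  refine ⟨hfi1, hfi2, hcont, hanti, hlim, hneg, hex, fun hstrict => ?_⟩
  have hsanti : StrictAnti w := by
    intro a b hab
    have i1 := strictMono_integral_exp_mul_translate hstrict hfi1 hab
    have i2 := strictMono_integral_exp_mul_translate hstrict hfi2 hab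
    dsimp only at i1 i2
    rw [hw, hw]
    gcongr
  obtain ⟨h, hh⟩ := hex
  exact ⟨h, hh, fun y hy => hsanti.injective (hy.trans hh.symm)⟩
end

section
/- Let q > 0, h* ∈ ℝ, σ ∈ [0, β⁺₁), C₀ > 0, and let δ : ℝ → ℝ be measurable and nondecreasing with 0 ≤ δ(x) ≤ C₀(1 + e^{σx}) for all x. Define w(x) = q^{−1} Σ_{j=1,2} (−a⁻_j) ∫_{−∞}^0 e^{−β⁻_j y} (δ(x+y) − δ(h*+y)) dy. Then for every x ≤ h*, all integrals below converge absolutely and Σ_{k=1,2} a⁺_k ∫_{h*−x}^∞ e^{−β⁺_k y} w(x+y) dy = q^{−1} Σ_{k=1,2} a⁺_k 𝒟⁺_k e^{β⁺_k(x−h*)}, where 𝒟⁺_k = Σ_{j=1,2} (−a⁻_j) ∫₀^∞ ∫_{−∞}^0 e^{−β⁻_j z − β⁺_k y} (δ(h*+y+z) − δ(h*+z)) dz dy. -/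
open MeasureTheory

/-- Exponential decay at `-∞` makes increments of `δ` integrable on the negative half line. -/
lemma integrableOn_exp_mul_increment {δ : ℝ → ℝ} (hmeas : Measurable δ) (hmono : Monotone δ)
    (hpos : ∀ x, 0 ≤ δ x) {b : ℝ} (hb : b < 0) (u h : ℝ) :
    IntegrableOn (fun y => Real.exp (-b * y) * (δ (u + y) - δ (h + y))) (Set.Iio 0) := by
  have hexp : IntegrableOn (fun y => Real.exp (-b * y)) (Set.Iio 0) :=
    (integrableOn_exp_mul_Iic (neg_pos.2 hb) 0).mono_set Set.Iio_subset_Iic_self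
  refine Integrable.mono' (hexp.mul_const (δ u + δ h)) (by fun_prop) ?_
  filter_upwards [ae_restrict_mem measurableSet_Iio] with y hy
  have hy' : y < 0 := hy
  have h1 := hmono (show u + y ≤ u by linarith)
  have h2 := hmono (show h + y ≤ h by linarith)
  have h3 := hpos (u + y)
  have h4 := hpos (h + y)
  rw [Real.norm_eq_abs, abs_mul, abs_of_pos (Real.exp_pos _)]
  gcongr
  rw [abs_le]
  constructor <;> linarith

/-- The double integrand defining the price coefficients is integrable on the quadrant. -/
lemma integrableOn_exp_mul_increment_prod {δ : ℝ → ℝ} (hmeas : Measurable δ)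
    (hmono : Monotone δ) {σ C : ℝ} (hC : 0 ≤ C) (hσ : 0 ≤ σ) (hpos : ∀ x, 0 ≤ δ x)
    (hbound : ∀ x, δ x ≤ C * (1 + Real.exp (σ * x)))
    {b c : ℝ} (hb : b < 0) (hc : σ < c) (h : ℝ) :
    IntegrableOn
      (fun p : ℝ × ℝ =>
        Real.exp (-b * p.2 - c * p.1) * (δ (h + p.1 + p.2) - δ (h + p.2)))
      (Set.Ioi (0 : ℝ) ×ˢ Set.Iio (0 : ℝ)) := by
  have hneg : IntegrableOn (fun y => Real.exp (-b * y)) (Set.Iio 0) :=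
    (integrableOn_exp_mul_Iic (neg_pos.2 hb) 0).mono_set Set.Iio_subset_Iic_self
  have hright : IntegrableOn
      (fun y => C * (1 + Real.exp (σ * h)) * Real.exp ((σ - c) * y)) (Set.Ioi 0) :=
    (integrableOn_exp_mul_Ioi (sub_neg.2 hc) 0).const_mul _
  have hdom := Integrable.mul_prod hright hneg
  rw [IntegrableOn, Measure.volume_eq_prod, ← Measure.prod_restrict]
  refine hdom.mono' (by fun_prop) ?_
  rw [Measure.prod_restrict]
  filter_upwards [ae_restrict_mem (measurableSet_Ioi.prod measurableSet_Iio)] with p hp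
  have hp1 : 0 < p.1 := hp.1
  have hp2 : p.2 < 0 := hp.2
  have hinc : 0 ≤ δ (h + p.1 + p.2) - δ (h + p.2) :=
    sub_nonneg.2 (hmono (by linarith))
  have hexp : Real.exp (σ * (h + p.1)) = Real.exp (σ * h) * Real.exp (σ * p.1) := by
    rw [← Real.exp_add]; ring_nf
  have hone : 1 ≤ Real.exp (σ * p.1) := Real.one_le_exp (by positivity)
  have hle : δ (h + p.1 + p.2) - δ (h + p.2)
      ≤ C * (1 + Real.exp (σ * h)) * Real.exp (σ * p.1) := by
    have h1 := hmono (show h + p.1 + p.2 ≤ h + p.1 by linarith)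
    have h2 := hbound (h + p.1)
    have h3 := hpos (h + p.2)
    rw [hexp] at h2
    nlinarith [mul_le_mul_of_nonneg_left hone hC]
  rw [Real.norm_eq_abs, abs_of_nonneg (mul_nonneg (Real.exp_pos _).le hinc)]
  calc _ ≤ Real.exp (-b * p.2 - c * p.1)
        * (C * (1 + Real.exp (σ * h)) * Real.exp (σ * p.1)) := by gcongr
    _ = C * (1 + Real.exp (σ * h))
        * (Real.exp (-b * p.2 - c * p.1) * Real.exp (σ * p.1)) := by ring
    _ = C * (1 + Real.exp (σ * h))
        * (Real.exp ((σ - c) * p.1) * Real.exp (-b * p.2)) := by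
      rw [← Real.exp_add, ← Real.exp_add]; ring_nf
    _ = _ := by ring

/-- Shifting the threshold to the origin in an exponentially weighted half-line integral. -/
lemma integrableOn_and_setIntegral_exp_mul_shift {F : ℝ → ℝ} {c x h : ℝ}
    (hF : IntegrableOn (fun t => Real.exp (-c * t) * F (h + t)) (Set.Ioi 0)) :
    IntegrableOn (fun y => Real.exp (-c * y) * F (x + y)) (Set.Ioi (h - x)) ∧
      ∫ y in Set.Ioi (h - x), Real.exp (-c * y) * F (x + y)
        = Real.exp (c * (x - h)) * ∫ t in Set.Ioi 0, Real.exp (-c * t) * F (h + t) := by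
  have hmp := measurePreserving_add_right (volume : Measure ℝ) (x - h)
  have hemb := measurableEmbedding_addRight (x - h)
  have hset : (fun y : ℝ => y + (x - h)) ⁻¹' Set.Ioi 0 = Set.Ioi (h - x) := by
    ext y
    simp only [Set.mem_preimage, Set.mem_Ioi]
    constructor <;> intro _ <;> linarith
  have hfun : (fun y => Real.exp (-c * y) * F (x + y)) =
      fun y => Real.exp (c * (x - h)) *
        (Real.exp (-c * (y + (x - h))) * F (h + (y + (x - h)))) := by
    ext y
    rw [← mul_assoc, ← Real.exp_add]
    ring_nf
  have hi := (hmp.integrableOn_comp_preimage hemb).2 hF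
  have he := hmp.setIntegral_preimage_emb hemb
    (fun t => Real.exp (-c * t) * F (h + t)) (Set.Ioi 0)
  rw [hset] at hi he
  rw [hfun]
  exact ⟨hi.const_mul _, by rw [integral_const_mul, he]⟩

/-- Discounted integrals over a half line of the negative Wiener–Hopf factor applied to `δ`. -/
lemma integrableOn_and_setIntegral_exp_mul_increment {δ : ℝ → ℝ} {b c x h : ℝ}
    (hint : IntegrableOn
      (fun p : ℝ × ℝ =>
        Real.exp (-b * p.2 - c * p.1) * (δ (h + p.1 + p.2) - δ (h + p.2)))
      (Set.Ioi (0 : ℝ) ×ˢ Set.Iio (0 : ℝ))) :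
    IntegrableOn (fun y => Real.exp (-c * y) *
        ∫ z in Set.Iio (0 : ℝ), Real.exp (-b * z) * (δ (x + y + z) - δ (h + z)))
      (Set.Ioi (h - x)) ∧
    ∫ y in Set.Ioi (h - x), Real.exp (-c * y) *
        ∫ z in Set.Iio (0 : ℝ), Real.exp (-b * z) * (δ (x + y + z) - δ (h + z))
      = Real.exp (c * (x - h)) * ∫ y in Set.Ioi (0 : ℝ), ∫ z in Set.Iio (0 : ℝ),
        Real.exp (-b * z - c * y) * (δ (h + y + z) - δ (h + z)) := by
  rw [IntegrableOn, Measure.volume_eq_prod, ← Measure.prod_restrict] at hint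
  have hi := hint.integral_prod_left
  have heq (y : ℝ) : ∫ z in Set.Iio (0 : ℝ),
        Real.exp (-b * z - c * y) * (δ (h + y + z) - δ (h + z))
      = Real.exp (-c * y) *
        ∫ z in Set.Iio (0 : ℝ), Real.exp (-b * z) * (δ (h + y + z) - δ (h + z)) := by
    rw [← integral_const_mul]
    congr 1 with z
    rw [← mul_assoc, ← Real.exp_add]
    ring_nf
  simp only [heq] at hi ⊢
  exact integrableOn_and_setIntegral_exp_mul_shift
    (F := fun u => ∫ z in Set.Iio (0 : ℝ), Real.exp (-b * z) * (δ (u + z) - δ (h + z))) hi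

/-- explicit formula for the rational price of the perpetual American
call on an asset with dividend stream `δ`, exercised at the threshold `h*`, in the
double-exponential jump-diffusion model. With
`w(x) = q⁻¹ Σ_j (−a⁻_j) ∫_{−∞}^0 e^{−β⁻_j y}(δ(x+y) − δ(h*+y)) dy`, for every `x ≤ h*`
all the integrals converge absolutely and
`Σ_k a⁺_k ∫_{h*−x}^∞ e^{−β⁺_k y} w(x+y) dy = q⁻¹ Σ_k a⁺_k 𝒟⁺_k e^{β⁺_k(x−h*)}`,
where `𝒟⁺_k = Σ_j (−a⁻_j) ∫₀^∞∫_{−∞}^0 e^{−β⁻_j z − β⁺_k y}(δ(h*+y+z) − δ(h*+z)) dz dy`. -/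
theorem stmt_13 (lp lm bm2 bm1 bp1 bp2 : ℝ)
    (ho1 : bm2 < lm) (ho2 : lm < bm1) (ho3 : bm1 < 0)
    (ho4 : 0 < bp1) (ho5 : bp1 < lp) (ho6 : lp < bp2)
    (ap1 ap2 am1 am2 : ℝ)
    (hap1 : ap1 = bp1 * bp2 * (lp - bp1) / ((bp2 - bp1) * lp))
    (hap2 : ap2 = bp1 * bp2 * (lp - bp2) / ((bp1 - bp2) * lp))
    (ham1 : am1 = bm1 * bm2 * (lm - bm1) / ((bm2 - bm1) * lm))
    (ham2 : am2 = bm1 * bm2 * (lm - bm2) / ((bm1 - bm2) * lm))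
    (q hstar σ C₀ : ℝ) (hq : 0 < q) (hσ1 : 0 ≤ σ) (hσ2 : σ < bp1) (hC₀ : 0 < C₀)
    (δ : ℝ → ℝ) (hmeas : Measurable δ) (hmono : Monotone δ)
    (hpos : ∀ x, 0 ≤ δ x) (hbound : ∀ x, δ x ≤ C₀ * (1 + Real.exp (σ * x)))
    (w : ℝ → ℝ)
    (hw : ∀ x : ℝ, w x = q⁻¹ *
      ((-am1) * (∫ y in Set.Iio (0 : ℝ), Real.exp (-bm1 * y) * (δ (x + y) - δ (hstar + y)))
        + (-am2) * (∫ y in Set.Iio (0 : ℝ), Real.exp (-bm2 * y) * (δ (x + y) - δ (hstar + y)))))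
    (D1 D2 : ℝ)
    (hD1 : D1 =
      (-am1) * (∫ y in Set.Ioi (0 : ℝ), ∫ z in Set.Iio (0 : ℝ),
        Real.exp (-bm1 * z - bp1 * y) * (δ (hstar + y + z) - δ (hstar + z)))
      + (-am2) * (∫ y in Set.Ioi (0 : ℝ), ∫ z in Set.Iio (0 : ℝ),
        Real.exp (-bm2 * z - bp1 * y) * (δ (hstar + y + z) - δ (hstar + z))))
    (hD2 : D2 =
      (-am1) * (∫ y in Set.Ioi (0 : ℝ), ∫ z in Set.Iio (0 : ℝ),
        Real.exp (-bm1 * z - bp2 * y) * (δ (hstar + y + z) - δ (hstar + z)))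
      + (-am2) * (∫ y in Set.Ioi (0 : ℝ), ∫ z in Set.Iio (0 : ℝ),
        Real.exp (-bm2 * z - bp2 * y) * (δ (hstar + y + z) - δ (hstar + z))))
    (x : ℝ) (hx : x ≤ hstar) :
    (∀ x' : ℝ, IntegrableOn
      (fun y => Real.exp (-bm1 * y) * (δ (x' + y) - δ (hstar + y))) (Set.Iio 0)) ∧
    (∀ x' : ℝ, IntegrableOn
      (fun y => Real.exp (-bm2 * y) * (δ (x' + y) - δ (hstar + y))) (Set.Iio 0)) ∧
    IntegrableOn (fun y => Real.exp (-bp1 * y) * w (x + y)) (Set.Ioi (hstar - x)) ∧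
    IntegrableOn (fun y => Real.exp (-bp2 * y) * w (x + y)) (Set.Ioi (hstar - x)) ∧
    (∀ bm' ∈ ({bm1, bm2} : Set ℝ), ∀ bp' ∈ ({bp1, bp2} : Set ℝ),
      IntegrableOn
        (fun p : ℝ × ℝ =>
          Real.exp (-bm' * p.2 - bp' * p.1) * (δ (hstar + p.1 + p.2) - δ (hstar + p.2)))
        (Set.Ioi (0 : ℝ) ×ˢ Set.Iio (0 : ℝ))) ∧
    ap1 * (∫ y in Set.Ioi (hstar - x), Real.exp (-bp1 * y) * w (x + y))
      + ap2 * (∫ y in Set.Ioi (hstar - x), Real.exp (-bp2 * y) * w (x + y))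
    = q⁻¹ * (ap1 * D1 * Real.exp (bp1 * (x - hstar))
        + ap2 * D2 * Real.exp (bp2 * (x - hstar))) := by
  have hb1 : bm1 < 0 := ho3
  have hb2 : bm2 < 0 := by linarith
  have hc2 : σ < bp2 := by linarith
  have hprod {b c : ℝ} (hb : b < 0) (hc : σ < c) :=
    integrableOn_exp_mul_increment_prod hmeas hmono hC₀.le hσ1 hpos hbound hb hc hstar
  have key {c : ℝ} (hc : σ < c) :
      IntegrableOn (fun y => Real.exp (-c * y) * w (x + y)) (Set.Ioi (hstar - x)) ∧
      ∫ y in Set.Ioi (hstar - x), Real.exp (-c * y) * w (x + y) =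
        q⁻¹ * Real.exp (c * (x - hstar)) *
        ((-am1) * (∫ y in Set.Ioi (0 : ℝ), ∫ z in Set.Iio (0 : ℝ),
          Real.exp (-bm1 * z - c * y) * (δ (hstar + y + z) - δ (hstar + z)))
        + (-am2) * (∫ y in Set.Ioi (0 : ℝ), ∫ z in Set.Iio (0 : ℝ),
          Real.exp (-bm2 * z - c * y) * (δ (hstar + y + z) - δ (hstar + z)))) := by
    obtain ⟨i1, e1⟩ :=
      integrableOn_and_setIntegral_exp_mul_increment (x := x) (hprod hb1 hc)
    obtain ⟨i2, e2⟩ :=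
      integrableOn_and_setIntegral_exp_mul_increment (x := x) (hprod hb2 hc)
    have hsplit : (fun y => Real.exp (-c * y) * w (x + y)) = fun y =>
        q⁻¹ * (-am1) * (Real.exp (-c * y) * ∫ z in Set.Iio (0 : ℝ),
          Real.exp (-bm1 * z) * (δ (x + y + z) - δ (hstar + z)))
        + q⁻¹ * (-am2) * (Real.exp (-c * y) * ∫ z in Set.Iio (0 : ℝ),
          Real.exp (-bm2 * z) * (δ (x + y + z) - δ (hstar + z))) := by
      ext y
      rw [hw]
      ring
    rw [hsplit]
    refine ⟨(i1.const_mul _).add (i2.const_mul _), ?_⟩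
    rw [integral_add (i1.const_mul _) (i2.const_mul _), integral_const_mul,
      integral_const_mul, e1, e2]
    ring
  obtain ⟨i1, e1⟩ := key hσ2
  obtain ⟨i2, e2⟩ := key hc2
  refine ⟨fun x' => integrableOn_exp_mul_increment hmeas hmono hpos hb1 x' hstar,
    fun x' => integrableOn_exp_mul_increment hmeas hmono hpos hb2 x' hstar,
    i1, i2, ?_, ?_⟩
  · rintro b (rfl | rfl) c (rfl | rfl)
    exacts [hprod hb1 hσ2, hprod hb1 hc2, hprod hb2 hσ2, hprod hb2 hc2]
  · rw [e1, e2, ← hD1, ← hD2]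
    ring
end

section
/- Let q > 0, h_* ∈ ℝ, σ ∈ [0, β⁺₁), C₀ > 0, and let δ : ℝ → ℝ be measurable and nondecreasing with 0 ≤ δ(x) ≤ C₀(1 + e^{σx}) for all x. Define w(x) = q^{−1} Σ_{k=1,2} a⁺_k ∫₀^∞ e^{−β⁺_k y} (δ(h_*+y) − δ(x+y)) dy. Then for every x ≥ h_*, all integrals below converge absolutely and Σ_{j=1,2} (−a⁻_j) ∫_{−∞}^{h_*−x} e^{−β⁻_j y} w(x+y) dy = q^{−1} Σ_{j=1,2} (−a⁻_j) 𝒟⁻_j e^{β⁻_j(x−h_*)}, where 𝒟⁻_j = Σ_{k=1,2} a⁺_k ∫₀^∞ ∫₀^∞ e^{β⁻_j y − β⁺_k z} (δ(h_*+z) − δ(h_*−y+z)) dz dy. -/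
open MeasureTheory

lemma integrableOn_exp_mul_shift {b σ C : ℝ} (hσ0 : 0 ≤ σ) (hσ : σ < b) {δ : ℝ → ℝ}
    (hmeas : Measurable δ) (hpos : ∀ x, 0 ≤ δ x)
    (hbound : ∀ x, δ x ≤ C * (1 + Real.exp (σ * x))) (c : ℝ) :
    IntegrableOn (fun z => Real.exp (-b * z) * δ (c + z)) (Set.Ioi 0) := by
  have h1 : IntegrableOn (fun z => Real.exp (-b * z)) (Set.Ioi 0) :=
    integrableOn_exp_mul_Ioi (by linarith) 0
  have h2 : IntegrableOn (fun z => Real.exp ((σ - b) * z)) (Set.Ioi 0) :=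
    integrableOn_exp_mul_Ioi (by linarith) 0
  have h3 := (h1.const_mul C).add (h2.const_mul (C * Real.exp (σ * c)))
  refine Integrable.mono' h3 (by fun_prop) (Filter.Eventually.of_forall fun z => ?_)
  rw [Real.norm_of_nonneg (mul_nonneg (Real.exp_pos _).le (hpos _))]
  refine (mul_le_mul_of_nonneg_left (hbound (c + z)) (Real.exp_pos _).le).trans (le_of_eq ?_)
  have e1 : Real.exp (σ * (c + z)) = Real.exp (σ * c) * Real.exp (σ * z) := by
    rw [← Real.exp_add]; ring_nf
  have e2 : Real.exp ((σ - b) * z) = Real.exp (σ * z) * Real.exp (-b * z) := by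
    rw [← Real.exp_add]; ring_nf
  simp only [Pi.add_apply, e1, e2]
  ring

lemma integrableOn_exp_mul_shift_sub {b σ C : ℝ} (hσ0 : 0 ≤ σ) (hσ : σ < b) {δ : ℝ → ℝ}
    (hmeas : Measurable δ) (hpos : ∀ x, 0 ≤ δ x)
    (hbound : ∀ x, δ x ≤ C * (1 + Real.exp (σ * x))) (c d : ℝ) :
    IntegrableOn (fun z => Real.exp (-b * z) * (δ (c + z) - δ (d + z))) (Set.Ioi 0) := by
  simp only [mul_sub]
  exact (integrableOn_exp_mul_shift hσ0 hσ hmeas hpos hbound c).sub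
    (integrableOn_exp_mul_shift hσ0 hσ hmeas hpos hbound d)

lemma integrableOn_prod_exp_mul_shift_sub {a b σ C : ℝ} (ha : a < 0) (hσ0 : 0 ≤ σ) (hσ : σ < b)
    {δ : ℝ → ℝ} (hmeas : Measurable δ) (hmono : Monotone δ) (hpos : ∀ x, 0 ≤ δ x)
    (hbound : ∀ x, δ x ≤ C * (1 + Real.exp (σ * x))) (c : ℝ) :
    IntegrableOn
      (fun p : ℝ × ℝ => Real.exp (a * p.1 - b * p.2) * (δ (c + p.2) - δ (c - p.1 + p.2)))
      (Set.Ioi (0 : ℝ) ×ˢ Set.Ioi (0 : ℝ)) := by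
  have h1 : IntegrableOn (fun y => Real.exp (a * y)) (Set.Ioi 0) :=
    integrableOn_exp_mul_Ioi ha 0
  have h2 : IntegrableOn (fun p : ℝ × ℝ => Real.exp (a * p.1) * (Real.exp (-b * p.2) * δ (c + p.2)))
      (Set.Ioi (0 : ℝ) ×ˢ Set.Ioi (0 : ℝ)) := by
    rw [IntegrableOn, Measure.volume_eq_prod, ← Measure.prod_restrict]
    exact Integrable.mul_prod h1 (integrableOn_exp_mul_shift hσ0 hσ hmeas hpos hbound c)
  refine Integrable.mono' h2 (by fun_prop) ?_
  filter_upwards [ae_restrict_mem (measurableSet_Ioi.prod measurableSet_Ioi)] with p hp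
  have hp1 : 0 < p.1 := hp.1
  have hle : δ (c - p.1 + p.2) ≤ δ (c + p.2) := hmono (by linarith)
  rw [Real.norm_of_nonneg (mul_nonneg (Real.exp_pos _).le (sub_nonneg.2 hle)), ← mul_assoc,
    ← Real.exp_add, show a * p.1 + -b * p.2 = a * p.1 - b * p.2 by ring]
  exact mul_le_mul_of_nonneg_left (by linarith [hpos (c - p.1 + p.2)]) (Real.exp_pos _).le

lemma exp_mul_integral_shift_sub (a b c y : ℝ) (δ : ℝ → ℝ) :
    ∫ z in Set.Ioi (0 : ℝ), Real.exp (a * y - b * z) * (δ (c + z) - δ (c - y + z))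
      = Real.exp (a * y) *
        ∫ z in Set.Ioi (0 : ℝ), Real.exp (-b * z) * (δ (c + z) - δ (c - y + z)) := by
  rw [← integral_const_mul]
  congr 1 with z
  rw [← mul_assoc, ← Real.exp_add]
  ring_nf

lemma integrableOn_exp_mul_integral_shift_sub {a b σ C : ℝ} (ha : a < 0) (hσ0 : 0 ≤ σ)
    (hσ : σ < b) {δ : ℝ → ℝ} (hmeas : Measurable δ) (hmono : Monotone δ) (hpos : ∀ x, 0 ≤ δ x)
    (hbound : ∀ x, δ x ≤ C * (1 + Real.exp (σ * x))) (c : ℝ) :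
    IntegrableOn (fun y => ∫ z in Set.Ioi (0 : ℝ),
      Real.exp (a * y - b * z) * (δ (c + z) - δ (c - y + z))) (Set.Ioi 0) := by
  have h := integrableOn_prod_exp_mul_shift_sub ha hσ0 hσ hmeas hmono hpos hbound c
  rw [IntegrableOn, Measure.volume_eq_prod, ← Measure.prod_restrict] at h
  exact h.integral_prod_left

lemma integrableOn_and_integral_Iio_exp_mul_comp_add {a h x D : ℝ} {w : ℝ → ℝ}
    (hint : IntegrableOn (fun t => Real.exp (a * t) * w (h - t)) (Set.Ioi 0))
    (hD : ∫ t in Set.Ioi (0 : ℝ), Real.exp (a * t) * w (h - t) = D) :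
    IntegrableOn (fun y => Real.exp (-a * y) * w (x + y)) (Set.Iio (h - x)) ∧
    ∫ y in Set.Iio (h - x), Real.exp (-a * y) * w (x + y) = Real.exp (a * (x - h)) * D := by
  have hmp : MeasurePreserving (fun y : ℝ => (h - x) - y) volume volume :=
    Measure.measurePreserving_sub_left volume (h - x)
  have hemb : MeasurableEmbedding (fun y : ℝ => (h - x) - y) :=
    (Homeomorph.subLeft (h - x)).measurableEmbedding
  have hpre : (fun y : ℝ => (h - x) - y) ⁻¹' Set.Ioi 0 = Set.Iio (h - x) := by
    ext y; simp
  have hfun : (fun y => Real.exp (-a * y) * w (x + y)) = fun y => Real.exp (a * (x - h)) *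
      ((fun t => Real.exp (a * t) * w (h - t)) ((h - x) - y)) := by
    funext y
    simp only
    rw [← mul_assoc, ← Real.exp_add]
    ring_nf
  have h1 := (hmp.integrableOn_comp_preimage hemb (s := Set.Ioi 0)).2 hint
  have h2 := hmp.setIntegral_preimage_emb hemb
    (fun t => Real.exp (a * t) * w (h - t)) (Set.Ioi 0)
  rw [hpre] at h1 h2
  rw [hfun]
  refine ⟨h1.const_mul _, ?_⟩
  rw [integral_const_mul, h2, hD]

lemma integrableOn_and_integral_Iio_exp_mul_price {a b₁ b₂ c₁ c₂ q h σ C : ℝ} (ha : a < 0)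
    (hσ0 : 0 ≤ σ) (hσ₁ : σ < b₁) (hσ₂ : σ < b₂) {δ : ℝ → ℝ} (hmeas : Measurable δ)
    (hmono : Monotone δ) (hpos : ∀ x, 0 ≤ δ x)
    (hbound : ∀ x, δ x ≤ C * (1 + Real.exp (σ * x))) {w : ℝ → ℝ}
    (hw : ∀ x : ℝ, w x = q⁻¹ *
      (c₁ * (∫ y in Set.Ioi (0 : ℝ), Real.exp (-b₁ * y) * (δ (h + y) - δ (x + y)))
        + c₂ * (∫ y in Set.Ioi (0 : ℝ), Real.exp (-b₂ * y) * (δ (h + y) - δ (x + y)))))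
    {D : ℝ}
    (hD : D =
      c₁ * (∫ y in Set.Ioi (0 : ℝ), ∫ z in Set.Ioi (0 : ℝ),
        Real.exp (a * y - b₁ * z) * (δ (h + z) - δ (h - y + z)))
      + c₂ * (∫ y in Set.Ioi (0 : ℝ), ∫ z in Set.Ioi (0 : ℝ),
        Real.exp (a * y - b₂ * z) * (δ (h + z) - δ (h - y + z)))) (x : ℝ) :
    IntegrableOn (fun y => Real.exp (-a * y) * w (x + y)) (Set.Iio (h - x)) ∧
    ∫ y in Set.Iio (h - x), Real.exp (-a * y) * w (x + y)
      = Real.exp (a * (x - h)) * (q⁻¹ * D) := by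
  have h1 := (integrableOn_exp_mul_integral_shift_sub ha hσ0 hσ₁ hmeas hmono hpos hbound h).const_mul
    c₁
  have h2 := (integrableOn_exp_mul_integral_shift_sub ha hσ0 hσ₂ hmeas hmono hpos hbound h).const_mul
    c₂
  have hfun : (fun t => Real.exp (a * t) * w (h - t)) = fun t => q⁻¹ *
      (c₁ * (∫ z in Set.Ioi (0 : ℝ), Real.exp (a * t - b₁ * z) * (δ (h + z) - δ (h - t + z)))
      + c₂ * (∫ z in Set.Ioi (0 : ℝ),
        Real.exp (a * t - b₂ * z) * (δ (h + z) - δ (h - t + z)))) := by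
    funext t
    rw [exp_mul_integral_shift_sub, exp_mul_integral_shift_sub, hw]
    ring
  apply integrableOn_and_integral_Iio_exp_mul_comp_add
  · rw [hfun]
    exact (h1.add h2).const_mul q⁻¹
  · rw [hfun, integral_const_mul, integral_add h1 h2, integral_const_mul, integral_const_mul, hD]

/-- explicit formula for the rational price of the perpetual American
put on an asset with dividend stream `δ`, exercised at the threshold `h_*`, in the
double-exponential jump-diffusion model. With
`w(x) = q⁻¹ Σ_k a⁺_k ∫₀^∞ e^{−β⁺_k y}(δ(h_*+y) − δ(x+y)) dy`, for every `x ≥ h_*`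
all the integrals converge absolutely and
`Σ_j (−a⁻_j) ∫_{−∞}^{h_*−x} e^{−β⁻_j y} w(x+y) dy = q⁻¹ Σ_j (−a⁻_j) 𝒟⁻_j e^{β⁻_j(x−h_*)}`,
where `𝒟⁻_j = Σ_k a⁺_k ∫₀^∞∫₀^∞ e^{β⁻_j y − β⁺_k z}(δ(h_*+z) − δ(h_*−y+z)) dz dy`. -/
theorem stmt_14 (lp lm bm2 bm1 bp1 bp2 : ℝ)
    (ho1 : bm2 < lm) (ho2 : lm < bm1) (ho3 : bm1 < 0)
    (ho4 : 0 < bp1) (ho5 : bp1 < lp) (ho6 : lp < bp2)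
    (ap1 ap2 am1 am2 : ℝ)
    (hap1 : ap1 = bp1 * bp2 * (lp - bp1) / ((bp2 - bp1) * lp))
    (hap2 : ap2 = bp1 * bp2 * (lp - bp2) / ((bp1 - bp2) * lp))
    (ham1 : am1 = bm1 * bm2 * (lm - bm1) / ((bm2 - bm1) * lm))
    (ham2 : am2 = bm1 * bm2 * (lm - bm2) / ((bm1 - bm2) * lm))
    (q hstar σ C₀ : ℝ) (hq : 0 < q) (hσ1 : 0 ≤ σ) (hσ2 : σ < bp1) (hC₀ : 0 < C₀)
    (δ : ℝ → ℝ) (hmeas : Measurable δ) (hmono : Monotone δ)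
    (hpos : ∀ x, 0 ≤ δ x) (hbound : ∀ x, δ x ≤ C₀ * (1 + Real.exp (σ * x)))
    (w : ℝ → ℝ)
    (hw : ∀ x : ℝ, w x = q⁻¹ *
      (ap1 * (∫ y in Set.Ioi (0 : ℝ), Real.exp (-bp1 * y) * (δ (hstar + y) - δ (x + y)))
        + ap2 * (∫ y in Set.Ioi (0 : ℝ), Real.exp (-bp2 * y) * (δ (hstar + y) - δ (x + y)))))
    (D1 D2 : ℝ)
    (hD1 : D1 =
      ap1 * (∫ y in Set.Ioi (0 : ℝ), ∫ z in Set.Ioi (0 : ℝ),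
        Real.exp (bm1 * y - bp1 * z) * (δ (hstar + z) - δ (hstar - y + z)))
      + ap2 * (∫ y in Set.Ioi (0 : ℝ), ∫ z in Set.Ioi (0 : ℝ),
        Real.exp (bm1 * y - bp2 * z) * (δ (hstar + z) - δ (hstar - y + z))))
    (hD2 : D2 =
      ap1 * (∫ y in Set.Ioi (0 : ℝ), ∫ z in Set.Ioi (0 : ℝ),
        Real.exp (bm2 * y - bp1 * z) * (δ (hstar + z) - δ (hstar - y + z)))
      + ap2 * (∫ y in Set.Ioi (0 : ℝ), ∫ z in Set.Ioi (0 : ℝ),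
        Real.exp (bm2 * y - bp2 * z) * (δ (hstar + z) - δ (hstar - y + z))))
    (x : ℝ) (hx : hstar ≤ x) :
    (∀ x' : ℝ, IntegrableOn
      (fun y => Real.exp (-bp1 * y) * (δ (hstar + y) - δ (x' + y))) (Set.Ioi 0)) ∧
    (∀ x' : ℝ, IntegrableOn
      (fun y => Real.exp (-bp2 * y) * (δ (hstar + y) - δ (x' + y))) (Set.Ioi 0)) ∧
    IntegrableOn (fun y => Real.exp (-bm1 * y) * w (x + y)) (Set.Iio (hstar - x)) ∧
    IntegrableOn (fun y => Real.exp (-bm2 * y) * w (x + y)) (Set.Iio (hstar - x)) ∧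
    (∀ bm' ∈ ({bm1, bm2} : Set ℝ), ∀ bp' ∈ ({bp1, bp2} : Set ℝ),
      IntegrableOn
        (fun p : ℝ × ℝ =>
          Real.exp (bm' * p.1 - bp' * p.2) * (δ (hstar + p.2) - δ (hstar - p.1 + p.2)))
        (Set.Ioi (0 : ℝ) ×ˢ Set.Ioi (0 : ℝ))) ∧
    (-am1) * (∫ y in Set.Iio (hstar - x), Real.exp (-bm1 * y) * w (x + y))
      + (-am2) * (∫ y in Set.Iio (hstar - x), Real.exp (-bm2 * y) * w (x + y))
    = q⁻¹ * ((-am1) * D1 * Real.exp (bm1 * (x - hstar))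
        + (-am2) * D2 * Real.exp (bm2 * (x - hstar))) := by
  have hσ3 : σ < bp2 := by linarith
  obtain ⟨i1, e1⟩ := integrableOn_and_integral_Iio_exp_mul_price ho3 hσ1 hσ2 hσ3 hmeas hmono hpos
    hbound hw hD1 x
  obtain ⟨i2, e2⟩ := integrableOn_and_integral_Iio_exp_mul_price (ho1.trans (ho2.trans ho3)) hσ1
    hσ2 hσ3 hmeas hmono hpos hbound hw hD2 x
  refine ⟨integrableOn_exp_mul_shift_sub hσ1 hσ2 hmeas hpos hbound hstar,
    integrableOn_exp_mul_shift_sub hσ1 hσ3 hmeas hpos hbound hstar, i1, i2, ?_, ?_⟩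
  · intro a ha b hb
    have ha0 : a < 0 := by rcases ha with rfl | rfl <;> linarith
    have hbσ : σ < b := by rcases hb with rfl | rfl <;> assumption
    exact integrableOn_prod_exp_mul_shift_sub ha0 hσ1 hbσ hmeas hmono hpos hbound hstar
  · rw [e1, e2]
    ring
end
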